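/- In the monoid M_Bii, if a·X = b·Y for elements X, Y of M_Bii, then there exists an element Z of M_Bii such that X = b·Z and Y = c·Z. -/

import Mathlib

/-- The three generators of the monoid `M_Bii`. -/
inductive BiiGen : Type
  | a | b | c

open FreeMonoid in
/-- The positive homogeneous relations `cbb = bba`, `bc = ab`, `ac = ca`. -/
def biiRel : FreeMonoid BiiGen → FreeMonoid BiiGen → Prop := fun x y =>
  (x = of .c * of .b * of .b ∧ y = of .b * of .b * of .a) ∨
  (x = of .b * of .c ∧ y = of .a * of .b) ∨
  (x = of .a * of .c ∧ y = of .c * of .a)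

/-- The monoid `M_Bii`: quotient of the free monoid on `{a,b,c}` by the congruence
generated by the relations `cbb = bba`, `bc = ab`, `ac = ca`. -/
abbrev MBii : Type := (conGen biiRel).Quotient

/-- The image of the generator `a` in `M_Bii`. -/
def MBii.a : MBii := (conGen biiRel).mk' (FreeMonoid.of BiiGen.a)
/-- The image of the generator `b` in `M_Bii`. -/
def MBii.b : MBii := (conGen biiRel).mk' (FreeMonoid.of BiiGen.b)
/-- The image of the generator `c` in `M_Bii`. -/
def MBii.c : MBii := (conGen biiRel).mk' (FreeMonoid.of BiiGen.c)

namespace MBii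

theorem b_mul_c : b * c = a * b :=
  (Con.eq _).2 (ConGen.Rel.of _ _ (.inr (.inl ⟨rfl, rfl⟩)))

theorem commute_a_c : Commute a c :=
  (Con.eq _).2 (ConGen.Rel.of _ _ (.inr (.inr ⟨rfl, rfl⟩)))

theorem c_mul_b_mul_b : c * b * b = b * b * a :=
  (Con.eq _).2 (ConGen.Rel.of _ _ (.inl ⟨rfl, rfl⟩))

theorem b_mul_c_pow (k : ℕ) : b * c ^ k = a ^ k * b :=
  SemiconjBy.pow_right (show SemiconjBy b c a from b_mul_c) k

theorem b_mul_b_mul_a_pow (k : ℕ) : b * b * a ^ k = c ^ k * (b * b) :=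
  SemiconjBy.pow_right
    (show SemiconjBy (b * b) a c from c_mul_b_mul_b.symm.trans (mul_assoc _ _ _)) k

/-- Exponents of a word `b ^ n * a ^ p * c ^ q * d ^ r`, where conjugation by `b` permutes the
commuting letters cyclically: `a * b = b * c`, `c * b = b * d`, `d * b = b * a`. -/
@[ext]
structure Exponents where
  n : ℕ
  p : ℕ
  q : ℕ
  r : ℕ

namespace Exponents

/-- The effect on exponents of multiplying by a generator on the right. -/
def step : BiiGen → Exponents → Exponents
  | .a, s => ⟨s.n, s.p + 1, s.q, s.r⟩
  | .b, s => ⟨s.n + 1, s.r, s.p, s.q⟩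
  | .c, s => ⟨s.n, s.p, s.q + 1, s.r⟩

/-- The exponents attained by elements of `MBii`: without a `b` there is no `d`. -/
def Valid (s : Exponents) : Prop := s.n = 0 → s.r = 0

/-- The element of `MBii` with given exponents. -/
def toMBii : Exponents → MBii
  | ⟨0, p, q, _⟩ => a ^ p * c ^ q
  | ⟨n + 1, p, q, r⟩ => b ^ n * c ^ r * b * a ^ p * c ^ q

theorem Valid.step {s : Exponents} (hs : s.Valid) (g : BiiGen) : (step g s).Valid := by
  cases g
  · exact hs
  · exact fun h => absurd h (Nat.succ_ne_zero _)
  · exact hs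

theorem toMBii_step_a (s : Exponents) : (step .a s).toMBii = s.toMBii * a := by
  obtain ⟨_ | n, p, q, r⟩ := s <;>
    simp only [step, toMBii, pow_succ, mul_assoc, (commute_a_c.pow_right q).eq]

theorem toMBii_step_c (s : Exponents) : (step .c s).toMBii = s.toMBii * c := by
  obtain ⟨_ | n, p, q, r⟩ := s <;> simp only [step, toMBii, pow_succ, mul_assoc]

theorem toMBii_step_b {s : Exponents} (hs : s.Valid) : (step .b s).toMBii = s.toMBii * b := by
  obtain ⟨_ | n, p, q, r⟩ := s
  · obtain rfl : r = 0 := hs rfl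
    calc b ^ 0 * c ^ q * b * a ^ 0 * c ^ p = c ^ q * (b * c ^ p) := by simp [mul_assoc]
      _ = (c ^ q * a ^ p) * b := by rw [b_mul_c_pow, mul_assoc]
      _ = a ^ p * c ^ q * b := by rw [(commute_a_c.pow_pow p q).eq]
  · calc b ^ (n + 1) * c ^ q * b * a ^ r * c ^ p
        = b ^ n * ((b * c ^ q) * b * a ^ r * c ^ p) := by simp only [pow_succ, mul_assoc]
      _ = b ^ n * (a ^ q * (b * b * a ^ r) * c ^ p) := by
          rw [b_mul_c_pow]; simp only [mul_assoc]
      _ = b ^ n * ((a ^ q * c ^ r) * (b * (b * c ^ p))) := by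
          rw [b_mul_b_mul_a_pow]; simp only [mul_assoc]
      _ = b ^ n * (c ^ r * (a ^ q * b) * (a ^ p * b)) := by
          rw [b_mul_c_pow, (commute_a_c.pow_pow q r).eq]; simp only [mul_assoc]
      _ = b ^ n * (c ^ r * b * (c ^ q * a ^ p) * b) := by
          rw [← b_mul_c_pow]; simp only [mul_assoc]
      _ = b ^ n * c ^ r * b * a ^ p * c ^ q * b := by
          rw [← (commute_a_c.pow_pow p q).eq]; simp only [mul_assoc]

theorem Valid.toMBii_step {s : Exponents} (hs : s.Valid) (g : BiiGen) :
    (Exponents.step g s).toMBii = s.toMBii * (conGen biiRel).mk' (FreeMonoid.of g) := by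
  cases g
  · exact toMBii_step_a s
  · exact toMBii_step_b hs
  · exact toMBii_step_c s

end Exponents

open Exponents MulOpposite

/-- The right action of `MBii` on exponents. -/
def act : MBii →* (Function.End Exponents)ᵐᵒᵖ :=
  (conGen biiRel).lift (FreeMonoid.lift fun g => op (step g)) <| Con.conGen_le.2 <| by
    rintro _ _ (⟨rfl, rfl⟩ | ⟨rfl, rfl⟩ | ⟨rfl, rfl⟩) <;> rfl

theorem act_mul (X Y : MBii) (s : Exponents) :
    (act (X * Y)).unop s = (act Y).unop ((act X).unop s) := by
  rw [map_mul]; rfl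

theorem act_mk_of (g : BiiGen) (s : Exponents) :
    (act ((conGen biiRel).mk' (FreeMonoid.of g))).unop s = step g s := rfl

theorem act_one (s : Exponents) : (act 1).unop s = s := by
  rw [map_one]; rfl

theorem act_a (s : Exponents) : (act a).unop s = ⟨s.n, s.p + 1, s.q, s.r⟩ := rfl

theorem act_b (s : Exponents) : (act b).unop s = ⟨s.n + 1, s.r, s.p, s.q⟩ := rfl

theorem act_c (s : Exponents) : (act c).unop s = ⟨s.n, s.p, s.q + 1, s.r⟩ := rfl

theorem act_a_pow (k : ℕ) (s : Exponents) : (act (a ^ k)).unop s = ⟨s.n, s.p + k, s.q, s.r⟩ := by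
  induction k with
  | zero => rw [pow_zero, act_one]; rfl
  | succ k ih => rw [pow_succ, act_mul, ih, act_a]; rfl

theorem act_c_pow (k : ℕ) (s : Exponents) : (act (c ^ k)).unop s = ⟨s.n, s.p, s.q + k, s.r⟩ := by
  induction k with
  | zero => rw [pow_zero, act_one]; rfl
  | succ k ih => rw [pow_succ, act_mul, ih, act_c]; rfl

@[elab_as_elim]
theorem induction_left {motive : MBii → Prop} (one : motive 1)
    (mul : ∀ g X, motive X → motive ((conGen biiRel).mk' (FreeMonoid.of g) * X)) (X : MBii) :
    motive X := by
  induction X using Con.induction_on with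
  | H w =>
    induction w using FreeMonoid.inductionOn' with
    | one => exact one
    | of_mul g w ih => exact mul g _ ih

theorem valid_act (X : MBii) {s : Exponents} (hs : s.Valid) : ((act X).unop s).Valid := by
  induction X using induction_left generalizing s with
  | one => rwa [act_one]
  | mul g X ih => rw [act_mul, act_mk_of]; exact ih (hs.step g)

theorem toMBii_act (X : MBii) {s : Exponents} (hs : s.Valid) :
    ((act X).unop s).toMBii = s.toMBii * X := by
  induction X using induction_left generalizing s with
  | one => rw [act_one, mul_one]
  | mul g X ih => rw [act_mul, act_mk_of, ih (hs.step g), hs.toMBii_step, mul_assoc]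

theorem act_n_succ (X : MBii) (s : Exponents) :
    (act X).unop ⟨s.n + 1, s.p, s.q, s.r⟩ =
      ⟨((act X).unop s).n + 1, ((act X).unop s).p, ((act X).unop s).q, ((act X).unop s).r⟩ := by
  induction X using induction_left generalizing s with
  | one => simp only [act_one]
  | mul g X ih =>
    simp only [act_mul, act_mk_of]
    rw [← ih]
    cases g <;> rfl

/-- The exponents of an element of `MBii`. -/
def exponents (X : MBii) : Exponents := (act X).unop ⟨0, 0, 0, 0⟩

theorem valid_exponents (X : MBii) : X.exponents.Valid := valid_act X fun _ => rfl

theorem toMBii_exponents (X : MBii) : X.exponents.toMBii = X := by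
  rw [exponents, toMBii_act X fun _ => rfl]
  simp [toMBii]

theorem exponents_b_mul (X : MBii) :
    (b * X).exponents = ⟨X.exponents.n + 1, X.exponents.p, X.exponents.q, X.exponents.r⟩ := by
  rw [exponents, act_mul]
  exact act_n_succ X _

theorem b_mul_left_cancel {X Y : MBii} (h : b * X = b * Y) : X = Y := by
  have h' := congrArg exponents h
  simp only [exponents_b_mul, Exponents.mk.injEq, Nat.add_right_cancel_iff] at h'
  rw [← toMBii_exponents X, ← toMBii_exponents Y]
  exact congrArg toMBii (Exponents.ext h'.1 h'.2.1 h'.2.2.1 h'.2.2.2)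

/-- If `b` divides `a * X` on the left, then it divides `X` on the left. -/
theorem b_dvd_of_a_mul_eq_b_mul {X Y : MBii} (h : a * X = b * Y) : b ∣ X := by
  have hX := toMBii_exponents X
  have hY := valid_exponents Y
  have h' := congrArg exponents h
  rw [exponents_b_mul] at h'
  generalize X.exponents = s at hX
  subst hX
  obtain ⟨_ | _ | n, p, q, r⟩ := s
  · rw [exponents] at h'
    simp only [toMBii, act_mul, act_a, act_a_pow, act_c_pow, Exponents.mk.injEq] at h'
    omega
  · simp only [toMBii, pow_zero, one_mul] at h' ⊢
    rw [exponents] at h'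
    simp only [act_mul, act_a, act_b, act_a_pow, act_c_pow, Exponents.mk.injEq] at h'
    obtain rfl : r = 0 := by have := hY (by omega); omega
    exact ⟨a ^ p * c ^ q, by simp [mul_assoc]⟩
  · exact ⟨b ^ n * c ^ r * b * a ^ p * c ^ q, by simp only [toMBii, pow_succ', mul_assoc]⟩

end MBii

theorem MBii_aX_eq_bY (X Y : MBii) (h : MBii.a * X = MBii.b * Y) :
    ∃ Z : MBii, X = MBii.b * Z ∧ Y = MBii.c * Z := by
  obtain ⟨Z, rfl⟩ := MBii.b_dvd_of_a_mul_eq_b_mul h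
  refine ⟨Z, rfl, MBii.b_mul_left_cancel ?_⟩
  rw [← h, ← mul_assoc, ← mul_assoc, MBii.b_mul_c]
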